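/- Let G be the automorphism group of a (q+1)-regular tree with fixed geodesic ]ω₋,ω₊[ through o, M := {γ ∈ K : γ fixes ]ω₋,ω₊[ pointwise}, and τ the one-step shift. Then the map φ : G/M⟨τ⟩ → (Ω × Ω)∖diag(Ω), gM⟨τ⟩ ↦ (gω₋, gω₊), is a well-defined G-equivariant bijection (G acting diagonally on Ω × Ω). -/

import Mathlib

def IsRay {V : Type} (G : SimpleGraph V) (f : ℕ → V) : Prop :=
  (∀ i, G.Adj (f i) (f (i + 1))) ∧ ∀ i, f (i + 2) ≠ f i

def RayEquiv {V : Type} (f g : ℕ → V) : Prop :=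
  ∃ m n : ℕ, ∀ i, f (m + i) = g (n + i)

def Boundary {V : Type} (G : SimpleGraph V) : Type :=
  Quot (fun f g : {f : ℕ → V // IsRay G f} => RayEquiv f.1 g.1)

def Boundary.map {V : Type} {G : SimpleGraph V} (e : G ≃g G) :
    Boundary G → Boundary G :=
  Quot.map
    (fun f => ⟨fun i => e (f.1 i),
      ⟨fun i => e.map_adj_iff.mpr (f.2.1 i),
       fun i h => f.2.2 i (e.toEquiv.injective h)⟩⟩)
    (fun _ _ h => by
      obtain ⟨m, n, hmn⟩ := h
      exact ⟨m, n, fun i => congrArg e (hmn i)⟩)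

namespace SimpleGraph

variable {V : Type} {G : SimpleGraph V}

lemma Connected.induction_adj (hG : G.Connected) {P : V → Prop} {x : V} (hx : P x)
    (hP : ∀ u v, G.Adj u v → P u → P v) (y : V) : P y := by
  have h := (reachable_iff_reflTransGen x y).mp (hG x y)
  induction h with
  | refl => exact hx
  | tail _ h ih => exact hP _ _ h ih

/-- In a tree, a vertex has at most one neighbour closer to a given vertex `b`. -/
lemma IsTree.eq_of_adj_of_dist_add_one (hG : G.IsTree) {b u y z : V}
    (hy : G.Adj y u) (hz : G.Adj z u)
    (hyb : G.dist b y + 1 = G.dist b u) (hzb : G.dist b z + 1 = G.dist b u) : y = z := by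
  obtain ⟨p, hp⟩ := hG.connected.exists_walk_length_eq_dist b y
  obtain ⟨r, hr⟩ := hG.connected.exists_walk_length_eq_dist b z
  have hp' : (p.concat hy).IsPath :=
    Walk.isPath_of_length_eq_dist _ (by rw [Walk.length_concat, hp, hyb])
  have hr' : (r.concat hz).IsPath :=
    Walk.isPath_of_length_eq_dist _ (by rw [Walk.length_concat, hr, hzb])
  have h := congrArg Walk.penultimate ((hG.existsUnique_path b u).unique hp' hr')
  simpa using h

lemma Iso.dist_apply (hG : G.Connected) (e : G ≃g G) (x y : V) :
    G.dist (e x) (e y) = G.dist x y := by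
  have key : ∀ (f : G ≃g G) (x y : V), G.dist (f x) (f y) ≤ G.dist x y := by
    intro f x y
    obtain ⟨p, hp⟩ := hG.exists_walk_length_eq_dist x y
    rw [← hp, ← Walk.length_map f.toHom p]
    exact dist_le _
  refine le_antisymm (key e x y) ?_
  simpa using key e.symm (e x) (e y)

/-! ### Extending partial isometries of a regular tree -/

/-- `R` is the graph of an isometry between two geodesically connected sets of vertices. -/
structure IsPartialIsometry (G : SimpleGraph V) (R : Set (V × V)) : Prop where
  dist_eq : ∀ p ∈ R, ∀ r ∈ R, G.dist p.1 r.1 = G.dist p.2 r.2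
  exists_adj : ∀ p ∈ R, ∀ r ∈ R, p ≠ r →
    ∃ s ∈ R, G.Adj s.1 p.1 ∧ G.dist r.1 s.1 + 1 = G.dist r.1 p.1

namespace IsPartialIsometry

variable {R : Set (V × V)}

lemma adj_iff (hR : G.IsPartialIsometry R) {p r : V × V} (hp : p ∈ R) (hr : r ∈ R) :
    G.Adj p.1 r.1 ↔ G.Adj p.2 r.2 := by
  rw [← dist_eq_one_iff_adj, hR.dist_eq p hp r hr, dist_eq_one_iff_adj]

lemma fst_eq_iff (hR : G.IsPartialIsometry R) (hG : G.Connected) {p r : V × V} (hp : p ∈ R)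
    (hr : r ∈ R) : p.1 = r.1 ↔ p.2 = r.2 := by
  rw [← hG.dist_eq_zero_iff, hR.dist_eq p hp r hr, hG.dist_eq_zero_iff]

lemma swap (hR : G.IsPartialIsometry R) : G.IsPartialIsometry (Prod.swap ⁻¹' R) where
  dist_eq p hp r hr := (hR.dist_eq _ hp _ hr).symm
  exists_adj p hp r hr hpr := by
    obtain ⟨s, hs, hsp, hd⟩ :=
      hR.exists_adj p.swap hp r.swap hr (fun h => hpr (Prod.swap_injective h))
    refine ⟨s.swap, by simpa using hs, (hR.adj_iff hs hp).mp hsp, ?_⟩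
    rw [hR.dist_eq _ hr _ hs, hR.dist_eq _ hr _ hp] at hd
    exact hd

lemma dist_leaf (hR : G.IsPartialIsometry R) (hG : G.IsTree) {p : V × V} (hp : p ∈ R) {v : V}
    (hv : G.Adj v p.1) (hvR : ∀ r ∈ R, r.1 ≠ v) {r : V × V} (hr : r ∈ R) :
    G.dist r.1 v = G.dist r.1 p.1 + 1 := by
  refine (hG.dist_eq_dist_add_one_of_adj r.1 hv).resolve_right fun h => ?_
  have hpr : p ≠ r := by
    rintro rfl
    simp at h
  obtain ⟨s, hs, hsp, hd⟩ := hR.exists_adj p hp r hr hpr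
  exact hvR s hs (hG.eq_of_adj_of_dist_add_one hsp hv hd h.symm)

lemma insert_leaf (hR : G.IsPartialIsometry R) (hG : G.IsTree) {p : V × V} (hp : p ∈ R) {v w : V}
    (hv : G.Adj v p.1) (hvR : ∀ r ∈ R, r.1 ≠ v) (hw : G.Adj w p.2) (hwR : ∀ r ∈ R, r.2 ≠ w) :
    G.IsPartialIsometry (insert (v, w) R) := by
  have h₁ := fun r hr => hR.dist_leaf hG hp hv hvR (r := r) hr
  have h₂ : ∀ r ∈ R, G.dist r.2 w = G.dist r.2 p.2 + 1 := fun r hr =>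
    hR.swap.dist_leaf hG (p := p.swap) (by simpa using hp) hw
      (fun r hr => hwR r.swap hr) (r := r.swap) (by simpa using hr)
  have h₃ : ∀ r ∈ R, G.dist r.1 v = G.dist r.2 w := fun r hr => by
    rw [h₁ r hr, h₂ r hr, hR.dist_eq r hr p hp]
  constructor
  · rintro r (rfl | hr) s (rfl | hs)
    · simp
    · simpa [dist_comm] using h₃ s hs
    · exact h₃ r hr
    · exact hR.dist_eq r hr s hs
  · rintro r (rfl | hr) s (rfl | hs) hrs
    · exact absurd rfl hrs
    · exact ⟨p, Or.inr hp, hv.symm, (h₁ s hs).symm⟩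
    · by_cases hrp : r = p
      · subst hrp
        exact ⟨(v, w), Or.inl rfl, hv, by simp [dist_eq_one_iff_adj.mpr hv]⟩
      · obtain ⟨s, hs, hsr, hd⟩ := hR.exists_adj r hr p hp hrp
        refine ⟨s, Or.inr hs, hsr, ?_⟩
        have e₁ := h₁ s hs
        have e₂ := h₁ r hr
        rw [dist_comm] at e₁ e₂
        rw [dist_comm (u := p.1), dist_comm (u := p.1)] at hd
        simp only
        omega
    · obtain ⟨t, ht, h⟩ := hR.exists_adj r hr s hs hrs
      exact ⟨t, Or.inr ht, h⟩

lemma exists_insert [G.LocallyFinite] {d : ℕ} (hreg : G.IsRegularOfDegree d)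
    (hR : G.IsPartialIsometry R) (hG : G.IsTree) {p : V × V} (hp : p ∈ R) {v : V}
    (hv : G.Adj v p.1) (hvR : ∀ r ∈ R, r.1 ≠ v) :
    ∃ w, G.IsPartialIsometry (insert (v, w) R) := by
  by_contra! hcon
  have h : ∀ w : G.neighborFinset p.2, ∃ r ∈ R, r.2 = w := by
    rintro ⟨w, hw⟩
    by_contra! hwR
    exact hcon w (hR.insert_leaf hG hp hv hvR ((G.mem_neighborFinset _ _).mp hw).symm hwR)
  choose f hfR hf using h
  have hfadj : ∀ w, (f w).1 ∈ G.neighborFinset p.1 := fun w => by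
    rw [mem_neighborFinset, hR.adj_iff hp (hfR w), hf, ← mem_neighborFinset]
    exact w.2
  let g : G.neighborFinset p.2 → G.neighborFinset p.1 := fun w => ⟨(f w).1, hfadj w⟩
  have hg : Function.Injective g := fun w w' h => by
    have := (hR.fst_eq_iff hG.connected (hfR w) (hfR w')).mp (congrArg Subtype.val h)
    rw [hf, hf] at this
    exact Subtype.ext this
  have hcard : Fintype.card (G.neighborFinset p.2) = Fintype.card (G.neighborFinset p.1) := by
    simp only [Fintype.card_coe, card_neighborFinset_eq_degree, hreg.degree_eq]
  obtain ⟨w, hw⟩ := ((Fintype.bijective_iff_injective_and_card g).mpr ⟨hg, hcard⟩).2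
    ⟨v, (G.mem_neighborFinset _ _).mpr hv.symm⟩
  exact hvR _ (hfR w) (congrArg Subtype.val hw)

/-- In a regular tree, every partial isometry extends to an automorphism. -/
theorem exists_iso [G.LocallyFinite] {d : ℕ} (hreg : G.IsRegularOfDegree d)
    (hR : G.IsPartialIsometry R) (hG : G.IsTree) (hne : R.Nonempty) :
    ∃ e : G ≃g G, ∀ p ∈ R, e p.1 = p.2 := by
  obtain ⟨M, hRM, hM⟩ := zorn_subset_nonempty {R | G.IsPartialIsometry R} (by
    intro c hc hchain _
    have hdir : ∀ p ∈ ⋃₀ c, ∀ r ∈ ⋃₀ c, ∃ S ∈ c, p ∈ S ∧ r ∈ S := by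
      rintro p ⟨S, hS, hpS⟩ r ⟨T, hT, hrT⟩
      rcases hchain.total hS hT with h | h
      · exact ⟨T, hT, h hpS, hrT⟩
      · exact ⟨S, hS, hpS, h hrT⟩
    refine ⟨⋃₀ c, ⟨fun p hp r hr => ?_, fun p hp r hr hpr => ?_⟩,
      fun s hs => Set.subset_sUnion_of_mem hs⟩ <;> obtain ⟨S, hS, hpS, hrS⟩ := hdir p hp r hr
    · exact (hc hS).dist_eq p hpS r hrS
    · obtain ⟨s, hs, h⟩ := (hc hS).exists_adj p hpS r hrS hpr
      exact ⟨s, ⟨S, hS, hs⟩, h⟩) R hR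
  obtain ⟨p₀, hp₀⟩ := hne
  have hMI : G.IsPartialIsometry M := hM.prop
  have hfst : ∀ x, ∃ y, (x, y) ∈ M := by
    refine hG.connected.induction_adj (x := p₀.1) ⟨p₀.2, hRM hp₀⟩ ?_
    rintro u v huv ⟨y, hy⟩
    by_contra! hv
    obtain ⟨w, hw⟩ := hMI.exists_insert hreg hG hy huv.symm
      (by rintro ⟨a, b⟩ hr rfl; exact hv b hr)
    exact hv w (hM.le_of_ge hw (Set.subset_insert _ _) (Set.mem_insert _ _))
  have hsnd : ∀ x, ∃ y, (y, x) ∈ M := by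
    refine hG.connected.induction_adj (x := p₀.2) ⟨p₀.1, hRM hp₀⟩ ?_
    rintro u v huv ⟨y, hy⟩
    by_contra! hv
    obtain ⟨w, hw⟩ := hMI.swap.exists_insert hreg hG (p := (u, y)) hy huv.symm
      (by rintro ⟨a, b⟩ hr rfl; exact hv b hr)
    refine hv w (hM.le_of_ge hw.swap (fun r hr => Or.inr ?_) (Or.inl rfl))
    simpa using hr
  choose f hf using hfst
  choose g hg using hsnd
  refine ⟨⟨⟨f, g, fun x => ?_, fun x => ?_⟩, ?_⟩, fun p hp => ?_⟩
  · exact (hMI.fst_eq_iff hG.connected (hg (f x)) (hf x)).mpr rfl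
  · exact (hMI.fst_eq_iff hG.connected (hf (g x)) (hg x)).mp rfl
  · intro a b
    exact (hMI.adj_iff (hf a) (hf b)).symm
  · exact (hMI.fst_eq_iff hG.connected (hf p.1) (hRM hp)).mp rfl

end IsPartialIsometry

/-! ### Geodesic lines -/

/-- A bi-infinite path without backtracking. -/
structure IsLine (G : SimpleGraph V) (ℓ : ℤ → V) : Prop where
  adj : ∀ j, G.Adj (ℓ j) (ℓ (j + 1))
  ne : ∀ j, ℓ (j + 2) ≠ ℓ j

namespace IsLine

variable {ℓ ℓ' : ℤ → V}

lemma dist_add_nat (h : G.IsLine ℓ) (hG : G.IsTree) (j : ℤ) (n : ℕ) :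
    G.dist (ℓ j) (ℓ (j + n)) = n := by
  induction n using Nat.twoStepInduction with
  | zero => simp
  | one => simpa using h.adj j
  | more n ih₀ ih₁ =>
    push_cast at ih₁ ⊢
    have a₀ := h.adj (j + n)
    have a₁ := h.adj (j + n + 1)
    have hne := h.ne (j + n)
    rw [show j + n + 1 + 1 = j + (n + 2) by ring] at a₁
    rw [add_assoc j] at a₀ a₁ hne
    rcases hG.dist_eq_dist_add_one_of_adj (ℓ j) a₁ with h' | h'
    · exact absurd (hG.eq_of_adj_of_dist_add_one a₁.symm a₀ h'.symm (by omega)) hne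
    · omega

lemma dist_eq (h : G.IsLine ℓ) (hG : G.IsTree) (i j : ℤ) :
    G.dist (ℓ i) (ℓ j) = (j - i).natAbs := by
  rcases le_total i j with hij | hij
  · obtain ⟨n, rfl⟩ := Int.le.dest hij
    rw [h.dist_add_nat hG]; omega
  · obtain ⟨n, rfl⟩ := Int.le.dest hij
    rw [dist_comm, h.dist_add_nat hG]; omega

lemma injective (h : G.IsLine ℓ) (hG : G.IsTree) : Function.Injective ℓ := fun i j hij => by
  have := h.dist_eq hG i j
  rw [hij, dist_self] at this
  omega

lemma isPartialIsometry (h : G.IsLine ℓ) (h' : G.IsLine ℓ') (hG : G.IsTree) :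
    G.IsPartialIsometry (Set.range fun j => (ℓ j, ℓ' j)) where
  dist_eq := by
    rintro _ ⟨i, rfl⟩ _ ⟨j, rfl⟩
    simp only [h.dist_eq hG, h'.dist_eq hG]
  exists_adj := by
    rintro _ ⟨i, rfl⟩ _ ⟨j, rfl⟩ hij
    have hne : i ≠ j := by rintro rfl; exact hij rfl
    rcases lt_or_gt_of_ne hne with hlt | hlt
    · refine ⟨_, ⟨i + 1, rfl⟩, (h.adj i).symm, ?_⟩
      simp only [h.dist_eq hG]; omega
    · refine ⟨_, ⟨i - 1, rfl⟩, by simpa using h.adj (i - 1), ?_⟩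
      simp only [h.dist_eq hG]; omega

/-- Automorphisms of a regular tree act transitively on parametrized geodesic lines. -/
theorem exists_iso [G.LocallyFinite] {d : ℕ} (hreg : G.IsRegularOfDegree d) (hG : G.IsTree)
    (h : G.IsLine ℓ) (h' : G.IsLine ℓ') : ∃ e : G ≃g G, ∀ j, e (ℓ j) = ℓ' j := by
  obtain ⟨e, he⟩ := (h.isPartialIsometry h' hG).exists_iso hreg hG (Set.range_nonempty _)
  exact ⟨e, fun j => he _ ⟨j, rfl⟩⟩

/-- An automorphism fixing both tails of a geodesic line fixes the line pointwise. -/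
lemma fixes_of_fixes_tails (h : G.IsLine ℓ) (hG : G.IsTree) (g : G ≃g G) {a b : ℤ}
    (ha : ∀ j, a ≤ j → g (ℓ j) = ℓ j) (hb : ∀ j, j ≤ b → g (ℓ j) = ℓ j) (j : ℤ) :
    g (ℓ j) = ℓ j := by
  rcases le_total a j with haj | hja
  · exact ha j haj
  induction j, hja using Int.leInductionDown with
  | base => exact ha a le_rfl
  | pred j _ ih =>
    have hadj : G.Adj (ℓ (j - 1)) (ℓ j) := by simpa using h.adj (j - 1)
    have hfix := hb (min b (j - 1)) (min_le_left _ _)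
    have hd : G.dist (ℓ (min b (j - 1))) (ℓ (j - 1)) + 1 = G.dist (ℓ (min b (j - 1))) (ℓ j) := by
      rw [h.dist_eq hG, h.dist_eq hG]; omega
    refine hG.eq_of_adj_of_dist_add_one (b := ℓ (min b (j - 1))) (u := ℓ j) ?_ hadj ?_ hd
    · rw [← ih]
      exact g.map_adj_iff.mpr hadj
    · rw [← hfix, Iso.dist_apply hG.connected, hd]
      conv_rhs => rw [← ih, Iso.dist_apply hG.connected]

end IsLine

end SimpleGraph

section Ends

variable {V : Type} {G : SimpleGraph V}

lemma RayEquiv.refl (f : ℕ → V) : RayEquiv f f := ⟨0, 0, fun _ => rfl⟩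

lemma RayEquiv.symm {f g : ℕ → V} : RayEquiv f g → RayEquiv g f := by
  rintro ⟨m, n, h⟩
  exact ⟨n, m, fun i => (h i).symm⟩

lemma RayEquiv.trans {f g h : ℕ → V} : RayEquiv f g → RayEquiv g h → RayEquiv f h := by
  rintro ⟨m, n, hfg⟩ ⟨m', n', hgh⟩
  refine ⟨m + m', n' + n, fun i => ?_⟩
  rw [add_assoc, hfg, add_assoc, ← hgh]
  congr 1
  ring

lemma Boundary.mk_eq_mk_iff {f g : {f : ℕ → V // IsRay G f}} :
    (Quot.mk _ f : Boundary G) = Quot.mk _ g ↔ RayEquiv f.1 g.1 :=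
  Equivalence.quot_mk_eq_iff
    (r := fun f g : {f : ℕ → V // IsRay G f} => RayEquiv f.1 g.1)
    ⟨fun f => RayEquiv.refl f.1, RayEquiv.symm, RayEquiv.trans⟩ f g

instance : MulAction (G ≃g G) (Boundary G) where
  smul := Boundary.map
  one_smul := by rintro ⟨f⟩; rfl
  mul_smul := by rintro g h ⟨f⟩; rfl

lemma IsRay.shift {f : ℕ → V} (hf : IsRay G f) (k : ℕ) : IsRay G fun i => f (k + i) :=
  ⟨fun i => hf.1 (k + i), fun i => hf.2 (k + i)⟩

lemma IsRay.cons {f : ℕ → V} (hf : IsRay G f) {x : V} (hx : G.Adj x (f 0)) (hne : f 1 ≠ x) :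
    IsRay G fun i => Nat.casesOn i x f := by
  constructor
  · rintro (_ | i)
    · exact hx
    · exact hf.1 i
  · rintro (_ | i)
    · exact hne
    · exact hf.2 i

lemma IsRay.exists_equiv_from (hG : G.Connected) {f : ℕ → V} (hf : IsRay G f) (x : V) :
    ∃ g, IsRay G g ∧ g 0 = x ∧ RayEquiv g f := by
  refine hG.induction_adj (P := fun x => ∃ g, IsRay G g ∧ g 0 = x ∧ RayEquiv g f)
    ⟨f, hf, rfl, RayEquiv.refl f⟩ ?_ x
  rintro _ v huv ⟨g, hg, rfl, hgf⟩
  by_cases hv : g 1 = v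
  · refine ⟨_, hg.shift 1, hv, RayEquiv.trans ?_ hgf⟩
    exact ⟨0, 1, fun i => by simp⟩
  · refine ⟨_, hg.cons huv.symm hv, rfl, RayEquiv.trans ?_ hgf⟩
    exact ⟨1, 0, fun i => by rw [add_comm, zero_add]⟩

/-- Two inequivalent rays are, up to equivalence, the two halves of a geodesic line. -/
lemma exists_line_of_not_rayEquiv (hG : G.Connected) {r s : ℕ → V} (hr : IsRay G r)
    (hs : IsRay G s) (hrs : ¬ RayEquiv r s) :
    ∃ ℓ : ℤ → V, G.IsLine ℓ ∧ RayEquiv (fun i : ℕ => ℓ (-(i : ℤ))) r ∧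
      RayEquiv (fun i : ℕ => ℓ (i : ℤ)) s := by
  obtain ⟨t, ht, ht0, hts⟩ := hs.exists_equiv_from hG (r 0)
  have hex : ∃ n, r n ≠ t n := by
    by_contra! h
    exact hrs (funext h ▸ hts)
  classical
  obtain ⟨k, hk⟩ : ∃ k, Nat.find hex = k + 1 :=
    Nat.exists_eq_succ_of_ne_zero fun h => by
      have := Nat.find_spec hex
      rw [h] at this
      exact this ht0.symm
  have hne : r (k + 1) ≠ t (k + 1) := hk ▸ Nat.find_spec hex
  have heq : r k = t k := not_not.mp (Nat.find_min hex (m := k) (by omega))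
  let ℓ : ℤ → V := fun j => if 0 ≤ j then t (k + j.toNat) else r (k + (-j).toNat)
  have hpos : ∀ n : ℕ, ℓ n = t (k + n) := fun n => by simp [ℓ]
  have hneg : ∀ n : ℕ, ℓ (-(n : ℤ)) = r (k + n) := by
    rintro (_ | n)
    · simp [ℓ, heq]
    · simp only [ℓ]
      rw [if_neg (by omega)]
      congr 2
  refine ⟨ℓ, ⟨fun j => ?_, fun j => ?_⟩, ⟨0, k, fun i => ?_⟩,
    RayEquiv.trans ⟨0, k, fun i => ?_⟩ hts⟩
  · rcases le_or_gt 0 j with hj | hj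
    · obtain ⟨n, rfl⟩ := Int.eq_ofNat_of_zero_le hj
      have := hpos (n + 1)
      push_cast at this
      rw [this, hpos]
      exact ht.1 _
    · obtain ⟨n, rfl⟩ : ∃ n : ℕ, j = -((n + 1 : ℕ) : ℤ) := ⟨(-j - 1).toNat, by omega⟩
      rw [show -((n + 1 : ℕ) : ℤ) + 1 = -(n : ℤ) by push_cast; ring, hneg, hneg]
      exact (hr.1 _).symm
  · rcases le_or_gt 0 j with hj | hj
    · obtain ⟨n, rfl⟩ := Int.eq_ofNat_of_zero_le hj
      have := hpos (n + 2)
      push_cast at this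
      rw [this, hpos]
      exact ht.2 _
    · obtain ⟨n, rfl⟩ : ∃ n : ℕ, j = -((n + 1 : ℕ) : ℤ) := ⟨(-j - 1).toNat, by omega⟩
      rcases n with _ | n
      · rw [show -((0 + 1 : ℕ) : ℤ) + 2 = (1 : ℕ) by norm_num, hpos, hneg]
        exact hne.symm
      · rw [show -((n + 1 + 1 : ℕ) : ℤ) + 2 = -(n : ℤ) by push_cast; ring, hneg, hneg]
        exact (hr.2 _).symm
  · simp only [zero_add, hneg]
  · simp only [zero_add, hpos]

namespace SimpleGraph.IsLine

variable {ℓ : ℤ → V}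

lemma not_rayEquiv (h : G.IsLine ℓ) (hG : G.IsTree) :
    ¬ RayEquiv (fun i : ℕ => ℓ (-(i : ℤ))) (fun i : ℕ => ℓ (i : ℤ)) := by
  rintro ⟨m, n, hmn⟩
  have := h.injective hG (hmn 1)
  push_cast at this
  omega

lemma zpow_apply {τ : G ≃g G} (hτ : ∀ j, τ (ℓ j) = ℓ (j + 1)) (k j : ℤ) :
    (τ ^ k) (ℓ j) = ℓ (j + k) := by
  induction k with
  | zero => simp
  | succ n ih =>
    rw [add_comm (n : ℤ), zpow_one_add, RelIso.mul_apply, ih, hτ]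
    congr 1; ring
  | pred n ih =>
    rw [sub_eq_add_neg, add_comm (-(n : ℤ)), zpow_add, zpow_neg_one, RelIso.mul_apply, ih]
    rw [show j + -(n : ℤ) = j + (-1 + -(n : ℤ)) + 1 by ring, ← hτ, RelIso.inv_apply_self]

/-- An automorphism fixing both ends of a geodesic line becomes, after composing with a power of
the one-step shift, the identity on the line. -/
lemma exists_zpow_fixes (h : G.IsLine ℓ) (hG : G.IsTree) {τ : G ≃g G}
    (hτ : ∀ j, τ (ℓ j) = ℓ (j + 1)) (g : G ≃g G)
    (hm : RayEquiv (fun i : ℕ => g (ℓ (-(i : ℤ)))) (fun i : ℕ => ℓ (-(i : ℤ))))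
    (hp : RayEquiv (fun i : ℕ => g (ℓ (i : ℤ))) (fun i : ℕ => ℓ (i : ℤ))) :
    ∃ k : ℤ, ∀ j, (τ ^ k * g) (ℓ j) = ℓ j := by
  obtain ⟨m', n', hm⟩ := hm
  obtain ⟨m, n, hp⟩ := hp
  beta_reduce at hm hp
  have hd : (m : ℤ) + m' = n + n' := by
    have := SimpleGraph.Iso.dist_apply hG.connected g (ℓ (-(m' + 0 : ℕ))) (ℓ (m + 0 : ℕ))
    rw [hm 0, hp 0, h.dist_eq hG, h.dist_eq hG] at this
    omega
  refine ⟨m - n, h.fixes_of_fixes_tails hG _ (a := m) (b := -m') (fun j hj => ?_)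
    (fun j hj => ?_)⟩
  · obtain ⟨i, rfl⟩ := Int.le.dest hj
    have := hp i
    push_cast at this
    rw [RelIso.mul_apply, this, zpow_apply hτ]
    congr 1; ring
  · obtain ⟨i, hi⟩ := Int.le.dest hj
    have := hm i
    push_cast at this
    rw [show j = -((m' : ℤ) + i) by omega, RelIso.mul_apply, this, zpow_apply hτ]
    congr 1; omega

end SimpleGraph.IsLine

end Ends

/-- The map `φ : G/M⟨τ⟩ → (Ω × Ω)∖diag(Ω)`, `gM⟨τ⟩ ↦ (gω₋, gω₊)`, is a well-defined
`G`-equivariant bijection: `(gω₋, gω₊)` is always off the diagonal, two group elements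
have the same image iff they lie in the same `M⟨τ⟩`-coset, every off-diagonal pair is
attained, and the map intertwines left translation with the diagonal action. -/
theorem phi_equivariant_bijection
    (q : ℕ) (V : Type) (G : SimpleGraph V)
    (hT : G.IsTree) [G.LocallyFinite] (hreg : G.IsRegularOfDegree (q + 1))
    (ℓ : ℤ → V) (hadj : ∀ j : ℤ, G.Adj (ℓ j) (ℓ (j + 1)))
    (hnb : ∀ j : ℤ, ℓ (j + 2) ≠ ℓ j)
    (o : V) (ho : ℓ 0 = o)
    (hfray : IsRay G fun i : ℕ => ℓ (i : ℤ))
    (hbray : IsRay G fun i : ℕ => ℓ (-(i : ℤ)))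
    (τ : G ≃g G) (hτ : ∀ j : ℤ, τ (ℓ j) = ℓ (j + 1)) :
    -- `ω₊`, `ω₋` the two ends of the reference geodesic, `H = M⟨τ⟩`
    let ωp : Boundary G := Quot.mk _ ⟨_, hfray⟩
    let ωm : Boundary G := Quot.mk _ ⟨_, hbray⟩
    let H : Subgroup (G ≃g G) :=
      Subgroup.closure ({g : G ≃g G | ∀ j : ℤ, g (ℓ j) = ℓ j} ∪ {τ})
    (∀ g : G ≃g G, Boundary.map g ωm ≠ Boundary.map g ωp) ∧
    (∀ g g' : G ≃g G,
      (Boundary.map g ωm = Boundary.map g' ωm ∧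
       Boundary.map g ωp = Boundary.map g' ωp) ↔ g⁻¹ * g' ∈ H) ∧
    (∀ ω ω' : Boundary G, ω ≠ ω' →
      ∃ g : G ≃g G, Boundary.map g ωm = ω ∧ Boundary.map g ωp = ω') ∧
    (∀ γ g : G ≃g G,
      Boundary.map (γ * g) ωm = Boundary.map γ (Boundary.map g ωm) ∧
      Boundary.map (γ * g) ωp = Boundary.map γ (Boundary.map g ωp)) := by
  intro ωp ωm H
  have hℓ : G.IsLine ℓ := ⟨hadj, hnb⟩
  have hH : ∀ g : G ≃g G, (g • ωm = ωm ∧ g • ωp = ωp) ↔ g ∈ H := by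
    intro g
    constructor
    · rintro ⟨hm, hp⟩
      obtain ⟨k, hk⟩ := hℓ.exists_zpow_fixes hT hτ g (Boundary.mk_eq_mk_iff.mp hm)
        (Boundary.mk_eq_mk_iff.mp hp)
      have hτH : τ ^ k ∈ H := H.zpow_mem (Subgroup.subset_closure (Or.inr rfl)) k
      exact (H.mul_mem_cancel_left hτH).mp (Subgroup.subset_closure (Or.inl hk))
    · have hle : H ≤ MulAction.stabilizer (G ≃g G) ωm ⊓ MulAction.stabilizer (G ≃g G) ωp := by
        refine (Subgroup.closure_le _).mpr ?_
        rintro g (hg | rfl)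
        · exact ⟨Boundary.mk_eq_mk_iff.mpr ⟨0, 0, fun i => hg _⟩,
            Boundary.mk_eq_mk_iff.mpr ⟨0, 0, fun i => hg _⟩⟩
        · refine ⟨Boundary.mk_eq_mk_iff.mpr ⟨1, 0, fun i => ?_⟩,
            Boundary.mk_eq_mk_iff.mpr ⟨0, 1, fun i => ?_⟩⟩
          · refine (hτ _).trans ?_
            congr 1; push_cast; ring
          · refine (hτ _).trans ?_
            congr 1; push_cast; ring
      exact fun hg => hle hg
  refine ⟨fun g h => ?_, fun g g' => ?_, ?_, fun γ g => ⟨mul_smul γ g ωm, mul_smul γ g ωp⟩⟩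
  · have h' : ωm = ωp := MulAction.injective g h
    exact hℓ.not_rayEquiv hT (Boundary.mk_eq_mk_iff.mp h')
  · rw [← hH, mul_smul, mul_smul, inv_smul_eq_iff, inv_smul_eq_iff]
    exact and_congr eq_comm eq_comm
  · rintro ⟨r⟩ ⟨s⟩ hrs
    obtain ⟨ℓ', hℓ', hr, hs⟩ := exists_line_of_not_rayEquiv hT.connected r.2 s.2
      fun h => hrs (Boundary.mk_eq_mk_iff.mpr h)
    obtain ⟨e, he⟩ := hℓ.exists_iso hreg hT hℓ'
    refine ⟨e, Boundary.mk_eq_mk_iff.mpr ?_, Boundary.mk_eq_mk_iff.mpr ?_⟩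
    · simpa only [he] using hr
    · simpa only [he] using hs
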